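/- Let M₁, M₂ be graded R-modules and let f : M₁ → M₂ be a graded monomorphism. If C₁ is a graded classical 2-absorbing second submodule of M₁, then f(C₁) is a graded classical 2-absorbing second submodule of the graded R-module f(M₁). -/

import Mathlib

open Pointwise

section GradedDefs

variable {G : Type*} [Group G] [DecidableEq G] {R : Type*} [CommRing R]
  {M : Type*} [AddCommGroup M] [Module R M]

/-- `R` is a `G`-graded commutative ring via the additive subgroups `𝒜 α`:
`R_α R_β ⊆ R_{αβ}` and `R = ⊕_{α ∈ G} R_α`. -/
structure IsRingGrading (𝒜 : G → AddSubgroup R) : Prop where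
  one_mem : (1 : R) ∈ 𝒜 1
  mul_mem : ∀ ⦃α β : G⦄ ⦃r s : R⦄, r ∈ 𝒜 α → s ∈ 𝒜 β → r * s ∈ 𝒜 (α * β)
  isInternal : DirectSum.IsInternal 𝒜

/-- `M` is a graded module over the `G`-graded ring `R`:
`R_α M_β ⊆ M_{αβ}` and `M = ⊕_{α ∈ G} M_α`. -/
structure IsModuleGrading (𝒜 : G → AddSubgroup R) (ℳ : G → AddSubgroup M) : Prop where
  smul_mem : ∀ ⦃α β : G⦄ ⦃r : R⦄ ⦃m : M⦄, r ∈ 𝒜 α → m ∈ ℳ β → r • m ∈ ℳ (α * β)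
  isInternal : DirectSum.IsInternal ℳ

/-- A submodule `N` of `M` is a graded submodule iff `N = ⊕_{α ∈ G} (N ∩ M_α)`,
equivalently, every element of `N` is a sum of homogeneous elements of `N`. -/
def IsGradedSubmodule (ℳ : G → AddSubgroup M) (N : Submodule R M) : Prop :=
  ∀ n ∈ N, n ∈ Submodule.span R {m : M | m ∈ N ∧ ∃ α, m ∈ ℳ α}

/-- An ideal `I` of `R` is a graded ideal iff `I = ⊕_{α ∈ G} (I ∩ R_α)`. -/
def IsGradedIdeal (𝒜 : G → AddSubgroup R) (I : Ideal R) : Prop :=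
  ∀ r ∈ I, r ∈ Ideal.span {s : R | s ∈ I ∧ ∃ α, s ∈ 𝒜 α}

/-- A proper graded submodule `C` of `M` is completely graded irreducible if whenever
`C = ⋂_{λ ∈ Δ} C_λ` for a family of graded submodules `C_λ`, then `C = C_β` for some `β`. -/
def CompletelyGradedIrreducible (ℳ : G → AddSubgroup M) (C : Submodule R M) : Prop :=
  IsGradedSubmodule ℳ C ∧ C ≠ ⊤ ∧
    ∀ S : Set (Submodule R M), (∀ D ∈ S, IsGradedSubmodule ℳ D) → C = sInf S → C ∈ S

/-- A non-zero graded submodule `C` of `M` is a graded classical 2-absorbing second submodule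
if whenever `r, s, t ∈ h(R)`, `U` is a completely graded irreducible submodule of `M` and
`r·s·t·C ⊆ U`, then `r·s·C ⊆ U` or `s·t·C ⊆ U` or `r·t·C ⊆ U`. -/
def IsGrClassical2AbsorbingSecond (𝒜 : G → AddSubgroup R) (ℳ : G → AddSubgroup M)
    (C : Submodule R M) : Prop :=
  C ≠ ⊥ ∧ IsGradedSubmodule ℳ C ∧
    ∀ r s t : R, (∃ α, r ∈ 𝒜 α) → (∃ β, s ∈ 𝒜 β) → (∃ γ, t ∈ 𝒜 γ) →
      ∀ U : Submodule R M, CompletelyGradedIrreducible ℳ U →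
        r • s • t • C ≤ U → (r • s • C ≤ U ∨ s • t • C ≤ U ∨ r • t • C ≤ U)

/-- A non-zero graded submodule `C` of `M` is a graded strongly classical 2-absorbing second
submodule if whenever `r, s, t ∈ h(R)`, `U₁, U₂, U₃` are completely graded irreducible
submodules of `M` and `r·s·t·C ⊆ U₁ ∩ U₂ ∩ U₃`, then `r·s·C ⊆ U₁ ∩ U₂ ∩ U₃` or
`s·t·C ⊆ U₁ ∩ U₂ ∩ U₃` or `r·t·C ⊆ U₁ ∩ U₂ ∩ U₃`. -/
def IsGrStronglyClassical2AbsorbingSecond (𝒜 : G → AddSubgroup R) (ℳ : G → AddSubgroup M)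
    (C : Submodule R M) : Prop :=
  C ≠ ⊥ ∧ IsGradedSubmodule ℳ C ∧
    ∀ r s t : R, (∃ α, r ∈ 𝒜 α) → (∃ β, s ∈ 𝒜 β) → (∃ γ, t ∈ 𝒜 γ) →
      ∀ U₁ U₂ U₃ : Submodule R M, CompletelyGradedIrreducible ℳ U₁ →
        CompletelyGradedIrreducible ℳ U₂ → CompletelyGradedIrreducible ℳ U₃ →
        r • s • t • C ≤ U₁ ⊓ U₂ ⊓ U₃ →
        (r • s • C ≤ U₁ ⊓ U₂ ⊓ U₃ ∨ s • t • C ≤ U₁ ⊓ U₂ ⊓ U₃ ∨ r • t • C ≤ U₁ ⊓ U₂ ⊓ U₃)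

/-- A non-zero graded submodule `S` of `M` is a graded weakly second submodule if whenever
`r, s ∈ h(R)`, `N` is a graded submodule of `M` and `r·s·S ⊆ N`, then `r·S ⊆ N` or `s·S ⊆ N`. -/
def IsGrWeaklySecond (𝒜 : G → AddSubgroup R) (ℳ : G → AddSubgroup M)
    (S : Submodule R M) : Prop :=
  S ≠ ⊥ ∧ IsGradedSubmodule ℳ S ∧
    ∀ r s : R, (∃ α, r ∈ 𝒜 α) → (∃ β, s ∈ 𝒜 β) →
      ∀ N : Submodule R M, IsGradedSubmodule ℳ N →
        r • s • S ≤ N → (r • S ≤ N ∨ s • S ≤ N)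

/-- A proper graded ideal `I` of `R` is a graded 2-absorbing ideal if whenever `r, s, t ∈ h(R)`
with `r·s·t ∈ I`, then `r·s ∈ I` or `r·t ∈ I` or `s·t ∈ I`. -/
def IsGr2AbsorbingIdeal (𝒜 : G → AddSubgroup R) (I : Ideal R) : Prop :=
  I ≠ ⊤ ∧ IsGradedIdeal 𝒜 I ∧
    ∀ r s t : R, (∃ α, r ∈ 𝒜 α) → (∃ β, s ∈ 𝒜 β) → (∃ γ, t ∈ 𝒜 γ) →
      r * s * t ∈ I → (r * s ∈ I ∨ r * t ∈ I ∨ s * t ∈ I)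

end GradedDefs

/-- The grading induced on the image `f(M₁) = range f`, namely `f(M₁) ∩ (M₂)_α`. -/
def rangeGrading {G : Type*} {R : Type*} [CommRing R] {M₁ M₂ : Type*}
    [AddCommGroup M₁] [Module R M₁] [AddCommGroup M₂] [Module R M₂]
    (f : M₁ →ₗ[R] M₂) (ℳ₂ : G → AddSubgroup M₂) :
    G → AddSubgroup ↥(LinearMap.range f) :=
  fun α => (ℳ₂ α).comap (LinearMap.range f).subtype.toAddMonoidHom

section GradedMaps

variable {G : Type*} {R : Type*} [CommRing R]
  {M N : Type*} [AddCommGroup M] [Module R M] [AddCommGroup N] [Module R N]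
  {ℳ : G → AddSubgroup M} {𝒩 : G → AddSubgroup N}

/-- An injective graded homomorphism reflects homogeneity. -/
theorem mem_of_map_mem_of_injective [DecidableEq G]
    (hℳ : DirectSum.IsInternal ℳ) (h𝒩 : DirectSum.IsInternal 𝒩)
    (f : M →ₗ[R] N) (hf : ∀ α, ∀ m ∈ ℳ α, f m ∈ 𝒩 α) (hinj : Function.Injective f)
    {α : G} {m : M} (hm : f m ∈ 𝒩 α) : m ∈ ℳ α := by
  obtain ⟨x, rfl⟩ := hℳ.2 m
  let φ : ∀ β, ℳ β →+ 𝒩 β := fun β =>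
    (f.toAddMonoidHom.comp (ℳ β).subtype).codRestrict (𝒩 β) fun y => hf β y y.2
  have hφ : ∀ x, DirectSum.coeAddMonoidHom 𝒩 (DirectSum.map φ x) =
      f (DirectSum.coeAddMonoidHom ℳ x) := by
    intro x
    induction x using DirectSum.induction_on with
    | zero => simp
    | of β y =>
      rw [DirectSum.map_of, DirectSum.coeAddMonoidHom_of, DirectSum.coeAddMonoidHom_of]
      rfl
    | add x y hx hy => simp only [map_add, hx, hy]
  have hy : DirectSum.map φ x = DirectSum.of (fun β => 𝒩 β) α ⟨_, hm⟩ := by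
    apply h𝒩.1
    rw [hφ, DirectSum.coeAddMonoidHom_of]
  have hx : x = DirectSum.of (fun β => ℳ β) α (x α) := by
    refine DFinsupp.ext fun β => ?_
    by_cases h : β = α
    · subst h
      exact (DirectSum.of_eq_same (β := fun β => ℳ β) β _).symm
    · have h1 : φ β (x β) = 0 := by
        rw [← DirectSum.map_apply, hy, DirectSum.of_eq_of_ne _ _ _ h]
      have h2 : f (x β) = 0 := congrArg Subtype.val h1
      have h3 : x β = 0 := Subtype.ext (hinj (h2.trans (map_zero f).symm))
      exact h3.trans (DirectSum.of_eq_of_ne (β := fun β => ℳ β) _ _ _ h).symm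
  rw [hx, DirectSum.coeAddMonoidHom_of]
  exact (x α).2

theorem IsGradedSubmodule.map {C : Submodule R M} (hC : IsGradedSubmodule ℳ C)
    (f : M →ₗ[R] N) (hf : ∀ α, ∀ m ∈ ℳ α, f m ∈ 𝒩 α) :
    IsGradedSubmodule 𝒩 (C.map f) := by
  rintro _ ⟨m, hm, rfl⟩
  have h := Submodule.mem_map_of_mem (f := f) (hC m hm)
  rw [Submodule.map_span] at h
  refine Submodule.span_mono ?_ h
  rintro _ ⟨x, ⟨hx, α, hα⟩, rfl⟩
  exact ⟨Submodule.mem_map_of_mem hx, α, hf α x hα⟩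

theorem CompletelyGradedIrreducible.comap_equiv {U : Submodule R N}
    (hU : CompletelyGradedIrreducible 𝒩 U)
    (e : M ≃ₗ[R] N) (he : ∀ α m, e m ∈ 𝒩 α ↔ m ∈ ℳ α) :
    CompletelyGradedIrreducible ℳ (U.comap (e : M →ₗ[R] N)) := by
  have hsymm : ∀ α, ∀ n ∈ 𝒩 α, (e.symm : N →ₗ[R] M) n ∈ ℳ α := fun α n hn =>
    (he α _).1 (by simpa using hn)
  obtain ⟨hgr, hne, hirr⟩ := hU
  refine ⟨?_, ?_, ?_⟩
  · have h := hgr.map _ hsymm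
    rwa [Submodule.map_equiv_eq_comap_symm, LinearEquiv.symm_symm] at h
  · intro h
    apply hne
    rw [eq_top_iff]
    intro n _
    have : e.symm n ∈ U.comap (e : M →ₗ[R] N) := h ▸ Submodule.mem_top
    simpa using this
  · intro S hS hUS
    obtain ⟨D, hD, hDU⟩ := hirr ((Submodule.map (e : M →ₗ[R] N)) '' S)
      (by
        rintro _ ⟨D, hD, rfl⟩
        exact (hS D hD).map _ fun α m hm => (he α m).2 hm)
      (by
        ext n
        have h : e.symm n ∈ U.comap (e : M →ₗ[R] N) ↔ e.symm n ∈ sInf S := by rw [hUS]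
        simp only [Submodule.mem_comap, LinearEquiv.coe_coe, LinearEquiv.apply_symm_apply] at h
        rw [h, Submodule.mem_sInf, Submodule.mem_sInf, Set.forall_mem_image]
        simp only [Submodule.mem_map_equiv])
    rwa [← hDU, Submodule.comap_map_eq_of_injective e.injective]

theorem IsGrClassical2AbsorbingSecond.map_equiv [Group G] [DecidableEq G]
    {𝒜 : G → AddSubgroup R} {C : Submodule R M}
    (hC : IsGrClassical2AbsorbingSecond 𝒜 ℳ C)
    (e : M ≃ₗ[R] N) (he : ∀ α m, e m ∈ 𝒩 α ↔ m ∈ ℳ α) :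
    IsGrClassical2AbsorbingSecond 𝒜 𝒩 (C.map (e : M →ₗ[R] N)) := by
  obtain ⟨hne, hgr, habs⟩ := hC
  refine ⟨?_, hgr.map _ fun α m hm => (he α m).2 hm, ?_⟩
  · rwa [Ne, Submodule.map_eq_bot_iff]
  · intro r s t hr hs ht U hU h
    have hsmul : ∀ (a : R) (D : Submodule R M),
        a • D.map (e : M →ₗ[R] N) = (a • D).map (e : M →ₗ[R] N) := by
      intro a D
      ext n
      simp [Submodule.mem_smul_pointwise_iff_exists]
    simp only [hsmul, Submodule.map_le_iff_le_comap] at h ⊢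
    exact habs r s t hr hs ht _ (hU.comap_equiv e he) h

end GradedMaps

theorem stmt6 {G : Type*} [Group G] [DecidableEq G] {R : Type*} [CommRing R]
    {M₁ M₂ : Type*} [AddCommGroup M₁] [Module R M₁] [AddCommGroup M₂] [Module R M₂]
    (𝒜 : G → AddSubgroup R) (ℳ₁ : G → AddSubgroup M₁) (ℳ₂ : G → AddSubgroup M₂)
    (h𝒜 : IsRingGrading 𝒜) (hℳ₁ : IsModuleGrading 𝒜 ℳ₁)
    (hℳ₂ : IsModuleGrading 𝒜 ℳ₂)
    (f : M₁ →ₗ[R] M₂) (hfgr : ∀ α : G, ∀ m ∈ ℳ₁ α, f m ∈ ℳ₂ α)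
    (hfinj : Function.Injective f)
    (C₁ : Submodule R M₁) (hC₁ : IsGrClassical2AbsorbingSecond 𝒜 ℳ₁ C₁) :
    IsGrClassical2AbsorbingSecond 𝒜 (rangeGrading f ℳ₂)
      (Submodule.map f.rangeRestrict C₁) := by
  refine hC₁.map_equiv (LinearEquiv.ofInjective f hfinj) fun α m => ?_
  exact ⟨mem_of_map_mem_of_injective hℳ₁.isInternal hℳ₂.isInternal f hfgr hfinj, hfgr α m⟩
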